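/- Suppose (n, p) = (3, 2) and k ≥ 4 is an integer, or (n, p) = (5, 4) and k ≥ 6 is an integer. Let λ = √(k(k+n−1)/p), φ₀ = √((p − n/λ²)/(n−p)), and define g(φ) = (2·f₁(φ) + 1/5)·φ. Then g(φ) > 0 for φ ∈ (0, φ₀), and for every φ ∈ (0, φ₀): g'(φ) + 1 + (f₂(φ) − f₁(φ)·φ/g(φ)) · (1 + (φ + g(φ))²) > 0. Equivalently, the vector field X of (ODE2) satisfies g'(φ) > X₂(φ, g(φ))/X₁(φ, g(φ)) on (0, φ₀), so X points inward along the graph of g. -/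

import Mathlib

/-- `f₁(φ) = (λ²-1)p/(1+λ²φ²) - (n-p)`. -/
noncomputable def f1 (n p : ℕ) (lam φ : ℝ) : ℝ :=
  (lam ^ 2 - 1) * p / (1 + lam ^ 2 * φ ^ 2) - ((n : ℝ) - p)

/-- `f₂(φ) = (n-p) + p/(1+λ²φ²)`. -/
noncomputable def f2 (n p : ℕ) (lam φ : ℝ) : ℝ :=
  ((n : ℝ) - p) + (p : ℝ) / (1 + lam ^ 2 * φ ^ 2)

/-- Second component of the vector field of the autonomous system (ODE2). -/
noncomputable def X2 (n p : ℕ) (lam φ ψ : ℝ) : ℝ :=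
  -ψ - (f2 n p lam φ * ψ - f1 n p lam φ * φ) * (1 + (φ + ψ) ^ 2)

/-- The barrier function `g(φ) = (2f₁(φ) + 1/5)·φ` of Step 1 in Appendix A.4. -/
noncomputable def gbar (n p : ℕ) (lam φ : ℝ) : ℝ :=
  (2 * f1 n p lam φ + 1 / 5) * φ

/-- The barrier expression in the variables `b = f₁ + 1` and `M = p (λ² - 1)`. -/
lemma barrier_rational_pos {p b M : ℝ} (hp : p = 2 ∨ p = 4) (hb : 1 < b) (hM : b < M) :
    0 < 2 * b - 4 / 5 - 4 * b * (1 - b / M) +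
      (1 + p * b / M - (b - 1) / (2 * b - 9 / 5)) *
        (1 + p * (M - b) / (b * (M + p)) * (2 * b - 4 / 5) ^ 2) := by
  obtain ⟨x, rfl⟩ : ∃ x, b = 1 + x := ⟨b - 1, by ring⟩
  obtain ⟨y, rfl⟩ : ∃ y, M = 1 + x + y := ⟨M - (1 + x), by ring⟩
  have hx : 0 < x := by linarith
  have hy : 0 < y := by linarith
  have hp0 : 0 < p := by rcases hp with rfl | rfl <;> norm_num
  have h1 : 0 < 2 * (1 + x) - 9 / 5 := by linarith
  have h2 : 0 < 1 + x + y := by linarith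
  have h3 : 0 < 1 + x + y + p := by linarith
  have h4 : 0 < 1 + x := by linarith
  have key : 2 * (1 + x) - 4 / 5 - 4 * (1 + x) * (1 - (1 + x) / (1 + x + y)) +
      (1 + p * (1 + x) / (1 + x + y) - ((1 + x) - 1) / (2 * (1 + x) - 9 / 5)) *
        (1 + p * ((1 + x + y) - (1 + x)) / ((1 + x) * ((1 + x + y) + p)) *
          (2 * (1 + x) - 4 / 5) ^ 2) =
      ((-(4 / 5) * (1 + x + y) - 2 * (1 + x) * (1 + x + y) + 4 * (1 + x) ^ 2) * (1 + x) *
          (1 + x + y + p) * (2 * (1 + x) - 9 / 5) +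
        ((1 + x + y + p * (1 + x)) * (2 * (1 + x) - 9 / 5) - (1 + x + y) * x) *
          ((1 + x) * (1 + x + y + p) + p * y * (2 * (1 + x) - 4 / 5) ^ 2)) /
      ((1 + x + y) * (2 * (1 + x) - 9 / 5) * (1 + x) * (1 + x + y + p)) := by
    generalize hd : 2 * (1 + x) - 9 / 5 = d at *
    field_simp
    ring
  rw [key]
  refine div_pos ?_ (by positivity)
  rcases hp with rfl | rfl
  · have hq : 0 < 27 / 125 - 14 / 25 * x + 11 / 5 * x ^ 2 := by
      nlinarith [sq_nonneg (x - 7 / 55)]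
    have hpos : 0 < 63 / 25 + 732 / 25 * x + 354 / 5 * x ^ 2 + 1696 / 25 * x ^ 3 +
        139 / 5 * x ^ 4 + 4 * x ^ 5 +
        y * (186 / 125 + 1866 / 125 * x + 1526 / 25 * x ^ 2 + 438 / 5 * x ^ 3 + 40 * x ^ 4) +
        y ^ 2 * ((27 / 125 - 14 / 25 * x + 11 / 5 * x ^ 2) + 4 * x ^ 3) := by
      positivity
    exact hpos.trans_eq (by ring)
  · have hpos : 0 < 31 / 5 + 1816 / 25 * x + 3962 / 25 * x ^ 2 + 3196 / 25 * x ^ 3 +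
        199 / 5 * x ^ 4 + 4 * x ^ 5 +
        y * (26 / 5 + 1598 / 25 * x + 5958 / 25 * x ^ 2 + 1618 / 5 * x ^ 3 + 144 * x ^ 4) +
        y ^ 2 * (99 / 125 + 106 / 25 * x + 67 / 5 * x ^ 2 + 12 * x ^ 3) := by
      positivity
    exact hpos.trans_eq (by ring)

lemma hasDerivAt_gbar (n p : ℕ) (lam φ : ℝ) :
    HasDerivAt (gbar n p lam)
      (2 * f1 n p lam φ + 1 / 5 -
        4 * ((lam ^ 2 - 1) * p / (1 + lam ^ 2 * φ ^ 2)) *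
          (1 - 1 / (1 + lam ^ 2 * φ ^ 2))) φ := by
  have hs : 1 + lam ^ 2 * φ ^ 2 ≠ 0 := by positivity
  have h1 : HasDerivAt (fun x : ℝ => 1 + lam ^ 2 * x ^ 2) (lam ^ 2 * (2 * φ)) φ := by
    simpa using ((hasDerivAt_pow 2 φ).const_mul (lam ^ 2)).const_add 1
  have h2 := ((((hasDerivAt_const φ ((lam ^ 2 - 1) * (p : ℝ))).div h1 hs).sub_const
    ((n : ℝ) - p)).const_mul 2 |>.add_const (1 / 5)).mul (hasDerivAt_id φ)
  refine h2.congr_deriv ?_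
  simp only [f1, id, Pi.div_apply]
  field_simp
  ring

/-- The barrier inequality in codimension one holds as soon as `f₁ > 0` at `φ > 0`. -/
lemma barrier_pos_of_lt {n p : ℕ} (hn : n = p + 1) (hp : p = 2 ∨ p = 4) {lam φ : ℝ}
    (hφ : 0 < φ) (hlt : 1 + lam ^ 2 * φ ^ 2 < (lam ^ 2 - 1) * p) :
    0 < gbar n p lam φ ∧
      0 < deriv (gbar n p lam) φ + 1 +
        (f2 n p lam φ - f1 n p lam φ * φ / gbar n p lam φ) *
          (1 + (φ + gbar n p lam φ) ^ 2) := by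
  have hpR : (p : ℝ) = 2 ∨ (p : ℝ) = 4 := by
    rcases hp with rfl | rfl <;> norm_num
  have hp0 : (0 : ℝ) < p := by rcases hpR with h | h <;> rw [h] <;> norm_num
  have hnR : (n : ℝ) - p = 1 := by rw [hn]; push_cast; ring
  rw [(hasDerivAt_gbar n p lam φ).deriv]
  simp only [gbar, f1, f2, hnR]
  generalize (p : ℝ) = P at *
  generalize hL : lam ^ 2 = L at *
  have hL0 : 0 ≤ L := hL ▸ sq_nonneg lam
  have hs1 : 1 ≤ 1 + L * φ ^ 2 := by linarith [mul_nonneg hL0 (sq_nonneg φ)]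
  have hM : 0 < (L - 1) * P := by linarith
  have hL1 : 0 < L := by linarith [pos_of_mul_pos_left hM hp0.le]
  have hs : 1 < 1 + L * φ ^ 2 := by
    have : 0 < L * φ ^ 2 := by positivity
    linarith
  have hs0 : 0 < 1 + L * φ ^ 2 := by linarith
  set b := (L - 1) * P / (1 + L * φ ^ 2) with hb
  have hb1 : 1 < b := by rw [hb, lt_div_iff₀ hs0]; linarith
  have hbM : b < (L - 1) * P := div_lt_self hM hs
  have hinv : 1 / (1 + L * φ ^ 2) = b / ((L - 1) * P) := by
    rw [hb, div_right_comm, div_self hM.ne']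
  have hφ2 : φ ^ 2 = P * ((L - 1) * P - b) / (b * ((L - 1) * P + P)) := by
    have e1 : (L - 1) * P + P = L * P := by ring
    have e2 : b * (1 + L * φ ^ 2) = (L - 1) * P := div_mul_cancel₀ _ hs0.ne'
    rw [e1, eq_div_iff (by positivity)]
    linear_combination P * e2
  have hg : 0 < 2 * (b - 1) + 1 / 5 := by linarith
  refine ⟨mul_pos hg hφ, ?_⟩
  have hcore := barrier_rational_pos hpR hb1 hbM
  have hquot : (b - 1) * φ / ((2 * (b - 1) + 1 / 5) * φ) = (b - 1) / (2 * b - 9 / 5) := by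
    rw [mul_div_mul_right _ _ hφ.ne']; congr 1; ring
  have hP : P / (1 + L * φ ^ 2) = P * b / ((L - 1) * P) := by
    rw [div_eq_mul_one_div, hinv]; ring
  rw [hquot, hP, hinv]
  rw [← hφ2] at hcore
  convert hcore using 1
  ring

/-- The barrier inequality (B) of Step 1 in Appendix A.4 of Xu–Yang–Zhang: in
the Type (II) cases, `g(φ) > 0` on `(0,φ₀)` and the vector field `X` of (ODE2)
points inward along the graph of `g`, i.e.
`g'(φ) + 1 + (f₂(φ) - f₁(φ)φ/g(φ))(1 + (φ + g(φ))²) > 0`; equivalently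
`g'(φ) > X₂(φ,g(φ))/X₁(φ,g(φ))`. -/
theorem barrier_inequality_type_II (n p k : ℕ)
    (h : ((n, p) = (3, 2) ∧ 4 ≤ k) ∨ ((n, p) = (5, 4) ∧ 6 ≤ k))
    (lam φ₀ : ℝ)
    (hlam : lam = Real.sqrt ((k : ℝ) * ((k : ℝ) + n - 1) / p))
    (hφ₀ : φ₀ = Real.sqrt (((p : ℝ) - n / lam ^ 2) / ((n : ℝ) - p))) :
    ∀ φ : ℝ, 0 < φ → φ < φ₀ →
      0 < gbar n p lam φ ∧
      0 < deriv (gbar n p lam) φ + 1 +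
          (f2 n p lam φ - f1 n p lam φ * φ / gbar n p lam φ) *
            (1 + (φ + gbar n p lam φ) ^ 2) ∧
      X2 n p lam φ (gbar n p lam φ) / gbar n p lam φ <
        deriv (gbar n p lam) φ := by
  intro φ hφ hlt
  have hn : n = p + 1 ∧ (p = 2 ∨ p = 4) ∧ 0 < k := by
    simp only [Prod.mk.injEq] at h
    omega
  obtain ⟨hn, hp, hk⟩ := hn
  have hnR : (n : ℝ) = p + 1 := by rw [hn]; push_cast; ring
  have hp0 : (0 : ℝ) < p := by
    have : 0 < p := by omega
    exact_mod_cast this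
  have hk0 : (0 : ℝ) < k := by exact_mod_cast hk
  have hL : 0 < lam ^ 2 := by
    have : 0 < lam := by
      rw [hlam, hnR]
      apply Real.sqrt_pos.2
      have : (0 : ℝ) < k + (p + 1) - 1 := by linarith
      positivity
    positivity
  have hlt' : 1 + lam ^ 2 * φ ^ 2 < (lam ^ 2 - 1) * p := by
    rw [hφ₀, Real.lt_sqrt hφ.le, hnR, add_sub_cancel_left, div_one] at hlt
    have h1 := mul_lt_mul_of_pos_left hlt hL
    rw [mul_sub, mul_div_cancel₀ _ hL.ne'] at h1
    linarith
  obtain ⟨hg, hB⟩ := barrier_pos_of_lt hn hp hφ hlt'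
  refine ⟨hg, hB, ?_⟩
  have hX : X2 n p lam φ (gbar n p lam φ) / gbar n p lam φ =
      -1 - (f2 n p lam φ - f1 n p lam φ * φ / gbar n p lam φ) *
        (1 + (φ + gbar n p lam φ) ^ 2) := by
    simp only [X2]
    field_simp
  rw [hX]
  linarith
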